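/- arXiv:1803.08095 — 2 statements merged into one kernel-verified Lean document; each statement's English description precedes it below -/
import Mathlib

section
/- Let A be a set of positive integers and α a positive integer. Let p^A(n) denote the number of partitions of n into parts from A (unrestricted multiplicity) and p^A_α(n) the number of partitions of n into parts from A where each part appears at most α times. Then the generating function identity ∑_{n≥0} p^A(n) q^n = ∏_{i≥0} (∑_{n≥0} p^A_α(n) q^{(α+1)^i n}) holds as a formal power series or for |q| < 1. -/
/-- Number of partitions of `n` with all parts in `A`. -/
noncomputable def pA (A : Set ℕ) (n : ℕ) : ℕ :=
  Nat.card {p : n.Partition // ∀ a ∈ p.parts, a ∈ A}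

/-- Number of partitions of `n` with all parts in `A`, each part used at most `α` times. -/
noncomputable def pAres (A : Set ℕ) (α : ℕ) (n : ℕ) : ℕ :=
  Nat.card {p : n.Partition // (∀ a ∈ p.parts, a ∈ A) ∧ ∀ a, p.parts.count a ≤ α}

open Filter Topology

/-- A multiset of positive integers with sum at most `M` has weight `r ^ sum` equal to a product over
the possible parts `1, …, M`. -/
lemma pow_multiset_sum_eq_prod (r : ℝ) {s : Multiset ℕ} (hs : 0 ∉ s) {M : ℕ} (hM : s.sum ≤ M) :
    r ^ s.sum = ∏ i : Fin M, (r ^ ((i : ℕ) + 1)) ^ s.count ((i : ℕ) + 1) := by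
  have hsub : s.toFinset ⊆ Finset.Ico 1 (M + 1) := fun a ha ↦ by
    have ha' := Multiset.mem_toFinset.1 ha
    have h1 : a ≠ 0 := fun h ↦ hs (h ▸ ha')
    have h2 : a ≤ s.sum := Multiset.single_le_sum (fun _ _ ↦ Nat.zero_le _) a ha'
    rw [Finset.mem_Ico]
    omega
  have hsum : s.sum = ∑ i : Fin M, ((i : ℕ) + 1) * s.count ((i : ℕ) + 1) := by
    rw [Finset.sum_multiset_count_of_subset s _ hsub, Finset.sum_Ico_eq_sum_range,
      Fin.sum_univ_eq_sum_range (fun i ↦ (i + 1) * s.count (i + 1)) M]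
    refine Finset.sum_congr (by simp) fun i _ ↦ ?_
    rw [smul_eq_mul, mul_comm, add_comm]
  conv_lhs => rw [hsum]
  simp_rw [← pow_mul, Finset.prod_pow_eq_pow_sum]

/-- The partial Euler products `∏ (1 - r ^ k)⁻¹` are bounded uniformly. -/
lemma prod_geom_sum_le {r : ℝ} (h0 : 0 ≤ r) (h1 : r < 1) (M : ℕ) :
    ∏ i : Fin M, ∑ j ∈ Finset.range (M + 1), (r ^ ((i : ℕ) + 1)) ^ j ≤
      Real.exp ((1 - r)⁻¹ * (1 - r)⁻¹) := by
  have hr : 0 < 1 - r := by linarith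
  have hterm : ∀ i : ℕ, ∑ j ∈ Finset.range (M + 1), (r ^ (i + 1)) ^ j ≤
      Real.exp (r ^ i * (1 - r)⁻¹) := fun i ↦ by
    have hx0 : 0 ≤ r ^ (i + 1) := by positivity
    have hxr : r ^ (i + 1) ≤ r := pow_le_of_le_one h0 h1.le (by omega)
    have hxi : r ^ (i + 1) ≤ r ^ i := pow_le_pow_of_le_one h0 h1.le (by omega)
    have hx1 : 0 < 1 - r ^ (i + 1) := by linarith
    calc ∑ j ∈ Finset.range (M + 1), (r ^ (i + 1)) ^ j
        ≤ ∑' j, (r ^ (i + 1)) ^ j :=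
          (summable_geometric_of_lt_one hx0 (by linarith)).sum_le_tsum _ fun _ _ ↦ by positivity
      _ = (1 - r ^ (i + 1))⁻¹ := tsum_geometric_of_lt_one hx0 (by linarith)
      _ = r ^ (i + 1) * (1 - r ^ (i + 1))⁻¹ + 1 := by field_simp; ring
      _ ≤ r ^ i * (1 - r)⁻¹ + 1 := by gcongr
      _ ≤ _ := Real.add_one_le_exp _
  calc _ ≤ ∏ i : Fin M, Real.exp (r ^ (i : ℕ) * (1 - r)⁻¹) :=
        Finset.prod_le_prod (fun _ _ ↦ by positivity) fun i _ ↦ hterm i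
    _ = Real.exp ((∑ i ∈ Finset.range M, r ^ i) * (1 - r)⁻¹) := by
        rw [← Real.exp_sum, Fin.sum_univ_eq_sum_range (fun i ↦ r ^ i * (1 - r)⁻¹), Finset.sum_mul]
    _ ≤ _ := by
        gcongr
        rw [← tsum_geometric_of_lt_one h0 h1]
        exact (summable_geometric_of_lt_one h0 h1).sum_le_tsum _ fun _ _ ↦ by positivity

lemma summable_pow_multiset_sum {Q : Multiset ℕ → Prop} (hQ : ∀ s, Q s → 0 ∉ s) {r : ℝ}
    (h0 : 0 ≤ r) (h1 : r < 1) : Summable fun s : {s // Q s} ↦ r ^ s.1.sum := by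
  refine summable_of_sum_le (c := Real.exp ((1 - r)⁻¹ * (1 - r)⁻¹))
    (fun s ↦ by positivity) fun F ↦ ?_
  set M := F.sup fun s ↦ s.1.sum
  have hM : ∀ s ∈ F, s.1.sum ≤ M := fun s hs ↦ Finset.le_sup (f := fun s ↦ s.1.sum) hs
  have hcount : ∀ s ∈ F, ∀ a, s.1.count a * a ≤ M := fun s hs a ↦ by
    refine le_trans ?_ (hM s hs)
    obtain ⟨t, ht⟩ := Multiset.le_iff_exists_add.1
      (Multiset.le_count_iff_replicate_le.1 (le_refl (s.1.count a)))
    have h := congrArg Multiset.sum ht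
    rw [Multiset.sum_add, Multiset.sum_replicate, smul_eq_mul] at h
    omega
  let φ : {s // Q s} → Fin M → ℕ := fun s i ↦ s.1.count ((i : ℕ) + 1)
  have hφ : Set.InjOn φ F := fun s hs t ht hst ↦ by
    ext1
    ext a
    rcases Nat.eq_zero_or_pos a with rfl | ha
    · rw [Multiset.count_eq_zero_of_notMem (hQ _ s.2), Multiset.count_eq_zero_of_notMem (hQ _ t.2)]
    · by_cases haM : a ≤ M
      · have := congrFun hst ⟨a - 1, by omega⟩
        simpa [φ, Nat.sub_add_cancel ha] using this
      · have h2 := hcount s hs a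
        have h3 := hcount t ht a
        have : ∀ c, c * a ≤ M → c = 0 := fun c hc ↦ by
          by_contra hne
          exact haM ((Nat.le_mul_of_pos_left a (Nat.pos_of_ne_zero hne)).trans hc)
        rw [this _ h2, this _ h3]
  calc ∑ s ∈ F, r ^ s.1.sum
      = ∑ s ∈ F, ∏ i : Fin M, (r ^ ((i : ℕ) + 1)) ^ φ s i :=
        Finset.sum_congr rfl fun s hs ↦ pow_multiset_sum_eq_prod r (hQ _ s.2) (hM s hs)
    _ = ∑ g ∈ F.image φ, ∏ i : Fin M, (r ^ ((i : ℕ) + 1)) ^ g i := by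
        rw [Finset.sum_image hφ]
    _ ≤ ∑ g ∈ Fintype.piFinset fun _ : Fin M ↦ Finset.range (M + 1),
          ∏ i : Fin M, (r ^ ((i : ℕ) + 1)) ^ g i := by
        refine Finset.sum_le_sum_of_subset_of_nonneg ?_ fun _ _ _ ↦ by positivity
        intro g hg
        obtain ⟨s, hs, rfl⟩ := Finset.mem_image.1 hg
        refine Fintype.mem_piFinset.2 fun i ↦ Finset.mem_range_succ_iff.2 ?_
        exact (Nat.le_mul_of_pos_right _ i.1.succ_pos).trans (hcount s hs _)
    _ = ∏ i : Fin M, ∑ j ∈ Finset.range (M + 1), (r ^ ((i : ℕ) + 1)) ^ j :=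
        (Finset.prod_univ_sum (fun _ ↦ Finset.range (M + 1))
          fun (i : Fin M) j ↦ (r ^ ((i : ℕ) + 1)) ^ j).symm
    _ ≤ _ := prod_geom_sum_le h0 h1 M

lemma summable_norm_pow_multiset_sum {Q : Multiset ℕ → Prop} (hQ : ∀ s, Q s → 0 ∉ s) {z : ℂ}
    (hz : ‖z‖ < 1) : Summable fun s : {s // Q s} ↦ ‖z ^ s.1.sum‖ := by
  simpa only [norm_pow] using summable_pow_multiset_sum hQ (norm_nonneg z) hz

/-- Multisets satisfying `Q`, graded by their sum, are the partitions satisfying `Q`. -/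
def sigmaPartitionEquiv {Q : Multiset ℕ → Prop} (hQ : ∀ s, Q s → 0 ∉ s) :
    (Σ n : ℕ, {p : n.Partition // Q p.parts}) ≃ {s // Q s} where
  toFun x := ⟨x.2.1.parts, x.2.2⟩
  invFun s := ⟨s.1.sum, ⟨s.1, fun {i} hi ↦ Nat.pos_of_ne_zero fun h ↦ hQ _ s.2 (h ▸ hi), rfl⟩, s.2⟩
  left_inv := by
    rintro ⟨n, ⟨s, hs, rfl⟩, hp⟩
    rfl
  right_inv _ := rfl

lemma hasSum_card_partition {Q : Multiset ℕ → Prop} (hQ : ∀ s, Q s → 0 ∉ s) {z : ℂ}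
    (hz : ‖z‖ < 1) :
    HasSum (fun n : ℕ ↦ (Nat.card {p : n.Partition // Q p.parts} : ℂ) * z ^ n)
      (∑' s : {s // Q s}, z ^ s.1.sum) := by
  have hs := (summable_norm_pow_multiset_sum hQ hz).of_norm.hasSum
  rw [← (sigmaPartitionEquiv hQ).hasSum_iff] at hs
  refine hs.sigma fun n ↦ ?_
  have : ∀ p : {p : n.Partition // Q p.parts},
      ((fun s : {s // Q s} ↦ z ^ s.1.sum) ∘ sigmaPartitionEquiv hQ) ⟨n, p⟩ = z ^ n := fun p ↦
    congrArg (z ^ ·) p.1.parts_sum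
  simp_rw [this]
  rw [← nsmul_eq_mul, ← tsum_const]
  have := Fintype.ofFinite {p : n.Partition // Q p.parts}
  exact (hasSum_fintype _).summable.hasSum

/-- Division with remainder of multiplicities by `m`. -/
lemma bijective_add_nsmul (A : Set ℕ) (α : ℕ) :
    Function.Bijective
      (fun x : {s : Multiset ℕ // (∀ a ∈ s, a ∈ A) ∧ ∀ a, s.count a ≤ α} ×
          {s : Multiset ℕ // ∀ a ∈ s, a ∈ A} ↦
        (⟨x.1.1 + (α + 1) • x.2.1, fun a ha ↦ (Multiset.mem_add.1 ha).elim (x.1.2.1 a)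
          fun h ↦ x.2.2 a (Multiset.mem_of_mem_nsmul h)⟩ :
          {s : Multiset ℕ // ∀ a ∈ s, a ∈ A})) := by
  constructor
  · rintro ⟨⟨u, hu⟩, ⟨t, ht⟩⟩ ⟨⟨u', hu'⟩, ⟨t', ht'⟩⟩ h
    have hc : ∀ a, u.count a + (α + 1) * t.count a = u'.count a + (α + 1) * t'.count a :=
      fun a ↦ by simpa using congrArg (Multiset.count a) (congrArg Subtype.val h)
    have hlt : ∀ a, u.count a < α + 1 := fun a ↦ Nat.lt_succ_of_le (hu.2 a)
    have hlt' : ∀ a, u'.count a < α + 1 := fun a ↦ Nat.lt_succ_of_le (hu'.2 a)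
    have h1 : u = u' := Multiset.ext.2 fun a ↦ by
      simpa [Nat.mod_eq_of_lt (hlt a), Nat.mod_eq_of_lt (hlt' a)] using congrArg (· % (α + 1)) (hc a)
    have h2 : t = t' := Multiset.ext.2 fun a ↦ by
      have := hc a
      rw [h1, Nat.add_left_cancel_iff] at this
      exact Nat.eq_of_mul_eq_mul_left α.succ_pos this
    subst h1 h2
    rfl
  · rintro ⟨s, hs⟩
    let u := Finsupp.toMultiset ((Multiset.toFinsupp s).mapRange (· % (α + 1)) (Nat.zero_mod _))
    let t := Finsupp.toMultiset ((Multiset.toFinsupp s).mapRange (· / (α + 1)) (Nat.zero_div _))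
    have hu : ∀ a, u.count a = s.count a % (α + 1) := fun a ↦ by simp [u, Finsupp.count_toMultiset]
    have ht : ∀ a, t.count a = s.count a / (α + 1) := fun a ↦ by simp [t, Finsupp.count_toMultiset]
    have hmem : ∀ a, s.count a ≠ 0 → a ∈ A := fun a h ↦
      hs a (Multiset.count_ne_zero.1 h)
    refine ⟨⟨⟨u, fun a ha ↦ hmem a fun h ↦ ?_, fun a ↦ ?_⟩, ⟨t, fun a ha ↦ hmem a fun h ↦ ?_⟩⟩, ?_⟩
    · exact Multiset.count_ne_zero.2 ha (by rw [hu, h, Nat.zero_mod])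
    · rw [hu]
      exact Nat.le_of_lt_succ (Nat.mod_lt _ α.succ_pos)
    · exact Multiset.count_ne_zero.2 ha (by rw [ht, h, Nat.zero_div])
    · refine Subtype.ext (Multiset.ext.2 fun a ↦ ?_)
      simp only [Multiset.count_add, Multiset.count_nsmul, hu, ht, Nat.mod_add_div]

/-- Near the origin, a power series with constant term `1` differs from `1` by `O(‖w‖)`. -/
lemma exists_norm_tsum_sub_one_le {c : ℕ → ℂ} (hc0 : c 0 = 1) {ρ : ℝ} (hρ : 0 < ρ)
    (hs : ∀ z : ℂ, ‖z‖ ≤ ρ → Summable fun n ↦ c n * z ^ n) :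
    ∃ C : ℝ, ∀ w : ℂ, ‖w‖ ≤ ρ → ‖∑' n, c n * w ^ n - 1‖ ≤ C * ‖w‖ := by
  have hρs : Summable fun n ↦ ‖c (n + 1)‖ * ρ ^ n := by
    have h := (summable_nat_add_iff 1).2 (hs (ρ : ℂ) (by simp [abs_of_pos hρ])).norm
    refine (h.mul_right ρ⁻¹).congr fun n ↦ ?_
    rw [norm_mul, norm_pow, Complex.norm_real, Real.norm_of_nonneg hρ.le, pow_succ]
    field_simp
  refine ⟨∑' n, ‖c (n + 1)‖ * ρ ^ n, fun w hw ↦ ?_⟩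
  rw [(hs w hw).tsum_eq_zero_add, hc0, pow_zero, mul_one, add_sub_cancel_left]
  refine tsum_of_norm_bounded (hρs.hasSum.mul_right ‖w‖) fun n ↦ ?_
  rw [norm_mul, norm_pow, pow_succ, ← mul_assoc]
  gcongr

/-- The functional equation `P(z) = R(z) P(z ^ (α + 1))` of the generating functions. -/
lemma tsum_pA_eq_mul {A : Set ℕ} (hA : ∀ a ∈ A, 0 < a) (α : ℕ) {z : ℂ} (hz : ‖z‖ < 1) :
    ∑' n, (pA A n : ℂ) * z ^ n =
      (∑' n, (pAres A α n : ℂ) * z ^ n) * ∑' n, (pA A n : ℂ) * (z ^ (α + 1)) ^ n := by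
  have hP : ∀ s : Multiset ℕ, (∀ a ∈ s, a ∈ A) → 0 ∉ s := fun s hs h ↦ (hA 0 (hs 0 h)).false
  have hR : ∀ s : Multiset ℕ, ((∀ a ∈ s, a ∈ A) ∧ ∀ a, s.count a ≤ α) → 0 ∉ s :=
    fun s hs ↦ hP s hs.1
  have hz' : ‖z ^ (α + 1)‖ < 1 := by
    rw [norm_pow]
    exact pow_lt_one₀ (norm_nonneg z) hz α.succ_ne_zero
  rw [show ∑' n, (pA A n : ℂ) * z ^ n = _ from (hasSum_card_partition hP hz).tsum_eq,
    show ∑' n, (pAres A α n : ℂ) * z ^ n = _ from (hasSum_card_partition hR hz).tsum_eq,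
    show ∑' n, (pA A n : ℂ) * (z ^ (α + 1)) ^ n = _ from (hasSum_card_partition hP hz').tsum_eq,
    tsum_mul_tsum_of_summable_norm (summable_norm_pow_multiset_sum hR hz)
      (summable_norm_pow_multiset_sum hP hz'),
    ← (Equiv.ofBijective _ (bijective_add_nsmul A α)).tsum_eq]
  refine tsum_congr fun x ↦ ?_
  rw [Equiv.ofBijective_apply, Multiset.sum_add, Multiset.sum_nsmul, smul_eq_mul, pow_add, pow_mul]

theorem stmt_3 (A : Set ℕ) (hA : ∀ a ∈ A, 0 < a) (α : ℕ) (hα : 1 ≤ α)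
    (q : ℂ) (hq : ‖q‖ < 1) :
    ∑' n : ℕ, (pA A n : ℂ) * q ^ n =
      ∏' i : ℕ, ∑' n : ℕ, (pAres A α n : ℂ) * q ^ ((α + 1) ^ i * n) := by
  have hP : ∀ s : Multiset ℕ, (∀ a ∈ s, a ∈ A) → 0 ∉ s := fun s hs h ↦ (hA 0 (hs 0 h)).false
  have hR : ∀ s : Multiset ℕ, ((∀ a ∈ s, a ∈ A) ∧ ∀ a, s.count a ≤ α) → 0 ∉ s :=
    fun s hs ↦ hP s hs.1
  obtain ⟨ρ, hqρ, hρ1⟩ := exists_between hq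
  have hρ : 0 < ρ := (norm_nonneg q).trans_lt hqρ
  obtain ⟨C, hC⟩ := exists_norm_tsum_sub_one_le (c := fun n ↦ (pA A n : ℂ))
    (by simp [pA]) hρ
    fun z hz ↦ (hasSum_card_partition hP (hz.trans_lt hρ1)).summable
  obtain ⟨D, hD⟩ := exists_norm_tsum_sub_one_le (c := fun n ↦ (pAres A α n : ℂ))
    (by simp [pAres]) hρ
    fun z hz ↦ (hasSum_card_partition hR (hz.trans_lt hρ1)).summable
  simp_rw [pow_mul]
  set P : ℂ → ℂ := fun z ↦ ∑' n, (pA A n : ℂ) * z ^ n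
  set R : ℂ → ℂ := fun z ↦ ∑' n, (pAres A α n : ℂ) * z ^ n
  set w : ℕ → ℂ := fun i ↦ q ^ (α + 1) ^ i
  change P q = ∏' i, R (w i)
  have hw : ∀ i, ‖w i‖ ≤ ‖q‖ ^ i := fun i ↦ by
    rw [norm_pow]
    exact pow_le_pow_of_le_one (norm_nonneg q) hq.le (Nat.lt_pow_self (by omega)).le
  have hw1 : ∀ i, ‖w i‖ ≤ ‖q‖ := fun i ↦ by
    rw [norm_pow]
    exact pow_le_of_le_one (norm_nonneg q) hq.le (by positivity)
  have hws : Summable fun i ↦ ‖w i‖ :=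
    (summable_geometric_of_lt_one (norm_nonneg q) hq).of_nonneg_of_le (fun _ ↦ norm_nonneg _) hw
  have hmul : Multipliable fun i ↦ R (w i) := by
    have : Summable fun i ↦ ‖R (w i) - 1‖ :=
      (hws.mul_left D).of_nonneg_of_le (fun _ ↦ norm_nonneg _) fun i ↦ hD _ ((hw1 i).trans hqρ.le)
    simpa using multipliable_one_add_of_summable this
  have hlim : Tendsto (fun N ↦ P (w N)) atTop (𝓝 1) := by
    rw [tendsto_iff_norm_sub_tendsto_zero]
    refine squeeze_zero (fun _ ↦ norm_nonneg _) (fun N ↦ hC _ ((hw1 N).trans hqρ.le)) ?_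
    simpa using hws.tendsto_atTop_zero.const_mul C
  have hfin : ∀ N, P q = (∏ i ∈ Finset.range N, R (w i)) * P (w N) := fun N ↦ by
    induction N with
    | zero => simp [w]
    | succ N ih =>
      rw [ih, Finset.prod_range_succ, mul_assoc]
      congr 1
      have := tsum_pA_eq_mul hA α ((hw1 N).trans_lt hq)
      rwa [← pow_mul, ← pow_succ] at this
  have := hmul.hasProd.tendsto_prod_nat.mul hlim
  simp_rw [← hfin, mul_one] at this
  exact tendsto_nhds_unique tendsto_const_nhds this
end

section
/- Let A be a set of positive integers, p̄^A(n) := E^A(n) − O^A(n) the signed count of unrestricted partitions of n into parts from A weighted by parity of number of parts, and p̄^A_1(n) := E^A_1(n) − O^A_1(n) the analogous signed count over partitions into distinct parts from A. Then for every n ≥ 1, p̄^A_1(n) = ∑ over all nonnegative integer solutions (N_0, N_1, ...) of n = ∑_{i≥0} 2^i N_i of ∏_{i≥0} p̄^A(N_i). -/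
/-- Signed count of partitions of `n` into parts from `A` by parity of number of parts. -/
noncomputable def pBar (A : Set ℕ) (n : ℕ) : ℤ :=
  (Nat.card {p : n.Partition // (∀ a ∈ p.parts, a ∈ A) ∧ Even (Multiset.card p.parts)} : ℤ) -
    (Nat.card {p : n.Partition // (∀ a ∈ p.parts, a ∈ A) ∧ Odd (Multiset.card p.parts)} : ℤ)

/-- Signed count of partitions of `n` into distinct parts from `A` by parity of number of parts. -/
noncomputable def pBar1 (A : Set ℕ) (n : ℕ) : ℤ :=
  (Nat.card {p : n.Partition //
      (∀ a ∈ p.parts, a ∈ A) ∧ p.parts.Nodup ∧ Even (Multiset.card p.parts)} : ℤ) -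
    (Nat.card {p : n.Partition //
      (∀ a ∈ p.parts, a ∈ A) ∧ p.parts.Nodup ∧ Odd (Multiset.card p.parts)} : ℤ)

open PowerSeries PowerSeries.WithPiTopology Finset

theorem Nat.Partition.card_even_sub_card_odd {n : ℕ} (Q : n.Partition → Prop)
    [DecidablePred Q] :
    (Nat.card {p : n.Partition // Q p ∧ Even (Multiset.card p.parts)} : ℤ) -
      (Nat.card {p : n.Partition // Q p ∧ Odd (Multiset.card p.parts)} : ℤ) =
    ∑ p : n.Partition, if Q p then (-1) ^ Multiset.card p.parts else 0 := by
  simp_rw [Nat.card_eq_fintype_card, Fintype.card_subtype, card_filter]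
  push_cast
  rw [← sum_sub_distrib]
  refine sum_congr rfl fun p _ ↦ ?_
  rcases Nat.even_or_odd (Multiset.card p.parts) with h | h
  · simp [h, h.neg_one_pow]
  · simp [h, h.neg_one_pow, ← Nat.not_odd_iff_even]
    split_ifs <;> simp

theorem Multiset.toFinsupp_prod_ite_neg_one_pow (s : Multiset ℕ) (P : ℕ → ℕ → Prop)
    [∀ a k, Decidable (P a k)] :
    s.toFinsupp.prod (fun a k ↦ if P a k then (-1 : ℤ) ^ k else 0) =
      if ∀ a ∈ s, P a (s.count a) then (-1) ^ Multiset.card s else 0 := by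
  change ∏ a ∈ s.toFinset, (if P a (s.count a) then (-1 : ℤ) ^ s.count a else 0) = _
  rw [prod_ite_zero, prod_pow_eq_pow_sum, Multiset.toFinset_sum_count_eq]
  simp only [Multiset.mem_toFinset]

open scoped Classical in
theorem mk_pBar (A : Set ℕ) :
    PowerSeries.mk (pBar A) =
      Nat.Partition.genFun (fun a k ↦ if a ∈ A then (-1 : ℤ) ^ k else 0) := by
  ext n
  rw [coeff_mk, Nat.Partition.coeff_genFun, pBar, Nat.Partition.card_even_sub_card_odd]
  exact sum_congr rfl fun p _ ↦
    (p.parts.toFinsupp_prod_ite_neg_one_pow fun a _ ↦ a ∈ A).symm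

open scoped Classical in
theorem mk_pBar1 (A : Set ℕ) :
    PowerSeries.mk (pBar1 A) =
      Nat.Partition.genFun (fun a k ↦ if a ∈ A ∧ k = 1 then (-1 : ℤ) ^ k else 0) := by
  ext n
  simp_rw [coeff_mk, Nat.Partition.coeff_genFun, pBar1, ← and_assoc]
  rw [Nat.Partition.card_even_sub_card_odd]
  refine sum_congr rfl fun p _ ↦ ?_
  rw [p.parts.toFinsupp_prod_ite_neg_one_pow fun a k ↦ a ∈ A ∧ k = 1]
  refine if_congr ?_ rfl rfl
  rw [forall₂_and]
  refine and_congr_right fun _ ↦ ⟨fun h a ha ↦ Multiset.count_eq_one_of_mem h ha, fun h ↦ ?_⟩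
  rw [Multiset.nodup_iff_count_le_one]
  intro a
  by_cases ha : a ∈ p.parts
  · exact (h a ha).le
  · simp [Multiset.count_eq_zero_of_notMem ha]

open scoped Classical in
theorem hasProd_mk_pBar1 (A : Set ℕ) :
    HasProd (fun i ↦ if i + 1 ∈ A then 1 - (X : ℤ⟦X⟧) ^ (i + 1) else 1)
      (PowerSeries.mk (pBar1 A)) := by
  rw [mk_pBar1]
  convert! Nat.Partition.hasProd_genFun
    (fun a k ↦ if a ∈ A ∧ k = 1 then (-1 : ℤ) ^ k else 0) using 1
  ext1 i
  rw [tsum_eq_single 0 fun j hj ↦ by simp [hj, smul_eq_C_mul]]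
  by_cases h : i + 1 ∈ A <;> simp [h, sub_eq_add_neg, smul_eq_C_mul]

open scoped Classical in
theorem hasProd_mk_pBar (A : Set ℕ) :
    HasProd (fun i ↦ if i + 1 ∈ A then ∑' j : ℕ, (-(X : ℤ⟦X⟧) ^ (i + 1)) ^ j else 1)
      (PowerSeries.mk (pBar A)) := by
  rw [mk_pBar]
  convert! Nat.Partition.hasProd_genFun (fun a k ↦ if a ∈ A then (-1 : ℤ) ^ k else 0) using 1
  ext1 i
  split_ifs with h
  · have hs : Summable fun j : ℕ ↦ (-(X : ℤ⟦X⟧) ^ (i + 1)) ^ j :=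
      summable_pow_of_constantCoeff_eq_zero (by simp)
    rw [tsum_eq_zero_add' ((summable_nat_add_iff 1).2 hs), pow_zero]
    congr 1
    refine tsum_congr fun j ↦ ?_
    rw [neg_pow, ← pow_mul, smul_eq_C_mul]
    simp
  · simp [smul_eq_C_mul]

theorem PowerSeries.WithPiTopology.continuous_expand {R : Type*} [CommRing R]
    [TopologicalSpace R] (p : ℕ) (hp : p ≠ 0) :
    Continuous (PowerSeries.expand p hp : R⟦X⟧ → R⟦X⟧) := by
  rw [continuous_iff_continuousAt]
  intro f
  rw [ContinuousAt, WithPiTopology.tendsto_iff_coeff_tendsto]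
  intro d
  simp_rw [coeff_expand]
  split_ifs
  · exact (continuous_coeff R _).tendsto f
  · exact tendsto_const_nhds

theorem mk_pBar1_eq_mul_expand (A : Set ℕ) :
    PowerSeries.mk (pBar1 A) =
      PowerSeries.mk (pBar A) * expand 2 two_ne_zero (PowerSeries.mk (pBar1 A)) := by
  classical
  have h := (hasProd_mk_pBar A).mul
    ((hasProd_mk_pBar1 A).map (expand 2 two_ne_zero) (continuous_expand 2 two_ne_zero))
  refine (hasProd_mk_pBar1 A).unique ?_
  convert! h using 1
  ext1 i
  simp only [Function.comp_apply]
  split_ifs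
  · have h1 : (∑' j : ℕ, (-(X : ℤ⟦X⟧) ^ (i + 1)) ^ j) * (1 - -(X : ℤ⟦X⟧) ^ (i + 1)) = 1 :=
      tsum_pow_mul_one_sub_of_constantCoeff_eq_zero (by simp)
    rw [map_sub, map_one, map_pow, expand_X]
    linear_combination -(1 - (X : ℤ⟦X⟧) ^ (i + 1)) * h1
  · simp

theorem mk_pBar1_eq_prod_mul_expand (A : Set ℕ) (m : ℕ) :
    PowerSeries.mk (pBar1 A) =
      (∏ i ∈ range m, expand (2 ^ i) (by positivity) (PowerSeries.mk (pBar A))) *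
        expand (2 ^ m) (by positivity) (PowerSeries.mk (pBar1 A)) := by
  induction m with
  | zero => simp
  | succ m ih =>
    conv_lhs => rw [ih, mk_pBar1_eq_mul_expand, map_mul, ← expand_mul, ← mul_assoc]
    rw [prod_range_succ]
    rfl

theorem pBar_zero (A : Set ℕ) : pBar A 0 = 1 := by
  simp [pBar, Nat.Partition.partition_zero_parts]

theorem pBar1_zero (A : Set ℕ) : pBar1 A 0 = 1 := by
  simp [pBar1, Nat.Partition.partition_zero_parts]

theorem pBar1_eq_coeff_prod (A : Set ℕ) (n : ℕ) :
    pBar1 A n =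
      coeff n (∏ i ∈ range n, expand (2 ^ i) (by positivity) (PowerSeries.mk (pBar A))) := by
  conv_lhs => rw [← coeff_mk n (pBar1 A), mk_pBar1_eq_prod_mul_expand A n, coeff_mul]
  rw [sum_eq_single (n, 0)]
  · simp [pBar1_zero]
  · rintro ⟨a, b⟩ hab hne
    rw [HasAntidiagonal.mem_antidiagonal] at hab
    rw [coeff_expand_of_not_dvd, mul_zero]
    intro hdvd
    have hb : b ≠ 0 := by
      rintro rfl
      exact hne (by simpa using hab)
    have := Nat.le_of_dvd (by omega) hdvd
    have := n.lt_two_pow_self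
    dsimp only at hab
    omega
  · simp

theorem stmt_11 (A : Set ℕ) (hA : ∀ a ∈ A, 0 < a) (n : ℕ) (hn : 1 ≤ n) :
    pBar1 A n =
      ∑ᶠ (f : ℕ →₀ ℕ) (_ : (f.sum fun i N => 2 ^ i * N) = n),
        ∏ᶠ i : ℕ, pBar A (f i) := by
  classical
  let e : (ℕ →₀ ℕ) → (ℕ →₀ ℕ) := fun f ↦
    Finsupp.onFinset f.support (fun i ↦ 2 ^ i * f i) (by simp)
  have e_apply (f : ℕ →₀ ℕ) (i : ℕ) : e f i = 2 ^ i * f i := rfl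
  have he : Function.Injective e := fun f g h ↦ by
    ext i
    simpa [e_apply] using DFunLike.congr_fun h i
  have hsum (f : ℕ →₀ ℕ) : (f.sum fun i N ↦ 2 ^ i * N) = (e f).sum fun _ N ↦ N :=
    (Finsupp.onFinset_sum (g := fun _ N ↦ N) _ fun _ ↦ rfl).symm
  have hmem (f : ℕ →₀ ℕ) : (f.sum fun i N ↦ 2 ^ i * N) = n ↔
      f ∈ (finsuppAntidiag (range n) n).preimage e he.injOn := by
    rw [mem_preimage, mem_finsuppAntidiag', hsum, iff_self_and]
    intro h i hi
    rw [mem_range]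
    have h1 : e f i ≤ n := h ▸ single_le_sum (f := e f) (fun _ _ ↦ Nat.zero_le _) hi
    have h2 : 2 ^ i ≤ e f i := by
      rw [Finsupp.mem_support_iff, e_apply] at hi
      exact Nat.le_mul_of_pos_right _ (Nat.pos_of_ne_zero (by simpa using hi))
    exact i.lt_two_pow_self.trans_le (h2.trans h1)
  rw [finsum_cond_eq_sum_of_cond_iff _ fun {f} _ ↦ hmem f, pBar1_eq_coeff_prod, coeff_prod,
    ← sum_preimage e _ he.injOn]
  · refine sum_congr rfl fun f hf ↦ ?_
    rw [finprod_eq_prod_of_mulSupport_subset (s := range n)]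
    · refine prod_congr rfl fun i _ ↦ ?_
      rw [e_apply, coeff_expand_mul, coeff_mk]
    · intro i hi
      rw [mem_preimage, mem_finsuppAntidiag] at hf
      refine hf.2 (Finsupp.mem_support_iff.2 fun h0 ↦ hi ?_)
      have : f i = 0 := by simpa [e_apply] using h0
      simp only [this, pBar_zero]
  · intro l hl hne
    by_contra hprod
    rw [← ne_eq, prod_ne_zero_iff] at hprod
    refine hne ⟨Finsupp.onFinset l.support (fun i ↦ l i / 2 ^ i) ?_, ?_⟩
    · intro i hi
      rw [Finsupp.mem_support_iff]
      rintro h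
      simp [h] at hi
    · ext i
      rw [e_apply, Finsupp.onFinset_apply]
      refine Nat.mul_div_cancel' ?_
      by_cases hi : i ∈ range n
      · by_contra hd
        exact hprod i hi (coeff_expand_of_not_dvd _ _ _ hd)
      · rw [Finsupp.notMem_support_iff.1 fun h ↦ hi ((mem_finsuppAntidiag.1 hl).2 h)]
        exact dvd_zero _
end
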